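/- arXiv:2601.15850 — 2 statements merged into one kernel-verified Lean document; each statement's English description precedes it below -/
import Mathlib

section
/- Define Θ : [0,∞) → ℝ by Θ(t) = −((3/4)(arccos√t − √(t−t²)))^{2/3} for 0 ≤ t < 1 and Θ(t) = ((3/4)(√(t²−t) − log(√t+√(t−1))))^{2/3} for t ≥ 1. Then: (i) Θ is infinitely differentiable on (0,∞); (ii) Θ′(t) > 0 for all t > 0; (iii) Θ(1) = 0; (iv) there exist C > 0 and δ > 0 such that |Θ(t) − 2^{−2/3}(t−1)| ≤ C(t−1)² for all t with |t−1| < δ; (v) for every ε > 0 there exists C_ε > 0 such that C_ε·t^{2/3} ≤ Θ(t) ≤ ((3/4)t)^{2/3} for all t ≥ 1+ε. -/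
open MeasureTheory Complex

noncomputable section

/-- The function `Θ`, defined by
`Θ(t) = −((3/4)(arccos √t − √(t−t²)))^{2/3}` for `0 ≤ t < 1` and
`Θ(t) = ((3/4)(√(t²−t) − log(√t+√(t−1))))^{2/3}` for `t ≥ 1`
(note `arccosh √t = log(√t+√(t−1))`). -/
def ThetaFun (t : ℝ) : ℝ :=
  if t < 1 then
    -(((3 / 4) * (Real.arccos (Real.sqrt t) - Real.sqrt (t - t ^ 2))) ^ ((2 : ℝ) / 3))
  else
    ((3 / 4) * (Real.sqrt (t ^ 2 - t) - Real.log (Real.sqrt t + Real.sqrt (t - 1)))) ^ ((2 : ℝ) / 3)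

/-- The integral `∫₀¹ vⁿ (1 + v² (t - 1))ᵖ dv`. -/
def weightedRpowIntegral (n : ℕ) (p t : ℝ) : ℝ :=
  ∫ v in (0 : ℝ)..1, v ^ n * (1 + v ^ 2 * (t - 1)) ^ p

lemma one_add_sq_mul_sub_one_pos {v t : ℝ} (hv : v ∈ Set.Icc (0 : ℝ) 1) (ht : 0 < t) :
    0 < 1 + v ^ 2 * (t - 1) := by
  obtain ⟨h0, h1⟩ := hv
  rcases h1.lt_or_eq with h | rfl
  · nlinarith [mul_nonneg (sq_nonneg v) ht.le, mul_self_nonneg v]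
  · linarith

lemma continuousOn_weightedRpow (n : ℕ) (p : ℝ) :
    ContinuousOn (fun z : ℝ × ℝ => z.2 ^ n * (1 + z.2 ^ 2 * (z.1 - 1)) ^ p)
      (Set.Ioi 0 ×ˢ Set.Icc 0 1) := by
  refine ContinuousOn.mul (by fun_prop) (ContinuousOn.rpow_const (by fun_prop) ?_)
  rintro ⟨t, v⟩ ⟨ht, hv⟩
  exact Or.inl (one_add_sq_mul_sub_one_pos hv ht).ne'

lemma continuousOn_weightedRpow_right (n : ℕ) (p : ℝ) {t : ℝ} (ht : 0 < t) :
    ContinuousOn (fun v : ℝ => v ^ n * (1 + v ^ 2 * (t - 1)) ^ p) (Set.Icc 0 1) :=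
  (continuousOn_weightedRpow n p).comp (f := fun v : ℝ => (t, v)) (by fun_prop)
    fun _ hv => ⟨ht, hv⟩

lemma intervalIntegrable_weightedRpow (n : ℕ) (p : ℝ) {t : ℝ} (ht : 0 < t) :
    IntervalIntegrable (fun v : ℝ => v ^ n * (1 + v ^ 2 * (t - 1)) ^ p) volume 0 1 :=
  ContinuousOn.intervalIntegrable_of_Icc zero_le_one (continuousOn_weightedRpow_right n p ht)

lemma hasDerivAt_weightedRpowIntegral (n : ℕ) (p : ℝ) {t : ℝ} (ht : 0 < t) :
    HasDerivAt (weightedRpowIntegral n p) (p * weightedRpowIntegral (n + 2) (p - 1) t) t := by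
  have hmem {x : ℝ} (hx : x ∈ Set.Icc (t / 2) (2 * t)) : 0 < x := by linarith [hx.1]
  have hI {v : ℝ} (hv : v ∈ Set.uIoc (0 : ℝ) 1) : v ∈ Set.Icc (0 : ℝ) 1 := by
    rw [Set.uIoc_of_le zero_le_one] at hv
    exact Set.Ioc_subset_Icc_self hv
  obtain ⟨C, hC⟩ := (isCompact_Icc.prod isCompact_Icc).exists_bound_of_continuousOn
    (((continuousOn_weightedRpow (n + 2) (p - 1)).const_smul p).mono
      (Set.prod_mono (fun x (hx : x ∈ Set.Icc (t / 2) (2 * t)) => hmem hx) subset_rfl))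
  have key := (intervalIntegral.hasDerivAt_integral_of_dominated_loc_of_deriv_le
    (μ := volume) (a := 0) (b := 1) (bound := fun _ => C)
    (F := fun t v : ℝ => v ^ n * (1 + v ^ 2 * (t - 1)) ^ p)
    (F' := fun t v : ℝ => p * (v ^ (n + 2) * (1 + v ^ 2 * (t - 1)) ^ (p - 1)))
    (s := Set.Icc (t / 2) (2 * t)) (x₀ := t)
    (Icc_mem_nhds (by linarith) (by linarith))
    ((lt_mem_nhds ht).mono fun x hx =>
      (intervalIntegrable_weightedRpow n p hx).aestronglyMeasurable_restrict_uIoc)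
    (intervalIntegrable_weightedRpow n p ht)
    ((intervalIntegrable_weightedRpow (n + 2) (p - 1) ht).const_mul p).aestronglyMeasurable_restrict_uIoc
    (.of_forall fun v hv x hx => hC (x, v) ⟨hx, hI hv⟩)
    intervalIntegrable_const
    (.of_forall fun v hv x hx => by
      have hpos := one_add_sq_mul_sub_one_pos (hI hv) (hmem hx)
      have h1 : HasDerivAt (fun x : ℝ => 1 + v ^ 2 * (x - 1)) (v ^ 2) x := by
        simpa using (((hasDerivAt_id x).sub_const 1).const_mul (v ^ 2)).const_add 1
      refine ((h1.rpow_const (p := p) (Or.inl hpos.ne')).const_mul (v ^ n)).congr_deriv ?_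
      ring)).2
  rwa [intervalIntegral.integral_const_mul] at key

lemma contDiffOn_weightedRpowIntegral (n : ℕ) (p : ℝ) :
    ContDiffOn ℝ (⊤ : ℕ∞) (weightedRpowIntegral n p) (Set.Ioi 0) := by
  refine contDiffOn_infty.2 fun k => ?_
  induction k generalizing n p with
  | zero =>
    exact contDiffOn_zero.2 fun t ht =>
      (hasDerivAt_weightedRpowIntegral n p ht).continuousAt.continuousWithinAt
  | succ k ih =>
    push_cast
    refine (contDiffOn_succ_iff_deriv_of_isOpen isOpen_Ioi).2 ⟨fun t ht =>
      (hasDerivAt_weightedRpowIntegral n p ht).differentiableAt.differentiableWithinAt,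
      by simp, ?_⟩
    exact (contDiffOn_const.mul (ih (n + 2) (p - 1))).congr fun t ht =>
      (hasDerivAt_weightedRpowIntegral n p ht).deriv

lemma weightedRpowIntegral_pos (n : ℕ) (p : ℝ) {t : ℝ} (ht : 0 < t) :
    0 < weightedRpowIntegral n p t :=
  intervalIntegral.intervalIntegral_pos_of_pos_on (intervalIntegrable_weightedRpow n p ht)
    (fun _ hv => mul_pos (pow_pos hv.1 n) (Real.rpow_pos_of_pos
      (one_add_sq_mul_sub_one_pos (Set.Ioo_subset_Icc_self hv) ht) p)) zero_lt_one

lemma weightedRpowIntegral_at_one (n : ℕ) (p : ℝ) :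
    weightedRpowIntegral n p 1 = 1 / (n + 1) := by
  simp [weightedRpowIntegral]

/-- Integration by parts: both sides equal `∫₀¹ (d/dv) [vⁿ⁺¹ (1 + v² (t - 1))ᵖ] dv`. -/
lemma weightedRpowIntegral_recurrence (n : ℕ) (p : ℝ) {t : ℝ} (ht : 0 < t) :
    (n + 1) * weightedRpowIntegral n p t +
      2 * (t - 1) * (p * weightedRpowIntegral (n + 2) (p - 1) t) = t ^ p := by
  have hi := ((intervalIntegrable_weightedRpow n p ht).const_mul (n + 1 : ℝ))
  have hj := ((intervalIntegrable_weightedRpow (n + 2) (p - 1) ht).const_mul (2 * (t - 1) * p))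
  have h := intervalIntegral.integral_eq_sub_of_hasDerivAt
    (f := fun v : ℝ => v ^ (n + 1) * (1 + v ^ 2 * (t - 1)) ^ p)
    (fun v hv => ?_) (hi.add hj)
  · rw [intervalIntegral.integral_add hi hj, intervalIntegral.integral_const_mul,
      intervalIntegral.integral_const_mul] at h
    simp only [weightedRpowIntegral]
    rw [← mul_assoc, h]
    simp
  · rw [Set.uIcc_of_le zero_le_one] at hv
    have hpos := one_add_sq_mul_sub_one_pos hv ht
    have h1 : HasDerivAt (fun v : ℝ => 1 + v ^ 2 * (t - 1)) (2 * v * (t - 1)) v := by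
      simpa using (((hasDerivAt_pow 2 v).mul_const (t - 1)).const_add 1)
    refine ((hasDerivAt_pow (n + 1) v).mul
      (h1.rpow_const (p := p) (Or.inl hpos.ne'))).congr_deriv ?_
    simp only [Nat.add_sub_cancel]
    push_cast
    ring

/-- On `[1, ∞)` the integrand of the weighted integral is bounded below by its value at `v = 1`. -/
lemma rpow_div_le_weightedRpowIntegral (n : ℕ) {p t : ℝ} (hp : p ≤ 0) (ht : 1 ≤ t) :
    t ^ p / (n + 1) ≤ weightedRpowIntegral n p t := by
  have ht0 : 0 < t := by linarith
  have h : ∫ v in (0 : ℝ)..1, v ^ n * t ^ p = t ^ p / (n + 1) := by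
    rw [intervalIntegral.integral_mul_const, integral_pow]
    simp
    ring
  rw [← h]
  refine intervalIntegral.integral_mono_on zero_le_one
    (Continuous.intervalIntegrable (by fun_prop) _ _)
    (intervalIntegrable_weightedRpow n p ht0) fun v hv => ?_
  refine mul_le_mul_of_nonneg_left (Real.rpow_le_rpow_of_nonpos
    (one_add_sq_mul_sub_one_pos hv ht0) ?_ hp) (pow_nonneg hv.1 n)
  nlinarith [mul_nonneg (sub_nonneg.2 ht) (sub_nonneg.2 (pow_le_one₀ hv.1 hv.2 : v ^ 2 ≤ 1))]

lemma rpow_neg_half_eq_inv_sqrt {x : ℝ} (hx : 0 ≤ x) : x ^ (-(1 / 2) : ℝ) = (√x)⁻¹ := by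
  rw [Real.rpow_neg hx, Real.sqrt_eq_rpow]

lemma mul_sqrt_sub_arsinh_eq {y : ℝ} (hy : 0 < y) :
    y * √(1 + y ^ 2) - Real.arsinh y =
      2 * y ^ 3 * weightedRpowIntegral 2 (-(1 / 2)) (1 + y ^ 2) := by
  have ht : 0 < 1 + y ^ 2 := by positivity
  have h := intervalIntegral.integral_eq_sub_of_hasDerivAt
    (f := fun v : ℝ => (y * v * √(1 + (y * v) ^ 2) - Real.arsinh (y * v)) / (2 * y ^ 3))
    (fun v hv => ?_) (intervalIntegrable_weightedRpow 2 (-(1 / 2)) ht)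
  · rw [weightedRpowIntegral, h]
    simp
    field_simp
  · have hpos : 0 < 1 + (y * v) ^ 2 := by positivity
    have hw : HasDerivAt (fun v : ℝ => y * v) y v := by
      simpa using (hasDerivAt_id v).const_mul y
    have hs : HasDerivAt (fun v : ℝ => 1 + (y * v) ^ 2) (2 * (y * v) * y) v := by
      simpa using (hw.pow 2).const_add 1
    refine (((hw.mul (hs.sqrt hpos.ne')).sub hw.arsinh).div_const (2 * y ^ 3)).congr_deriv ?_
    rw [show 1 + v ^ 2 * (1 + y ^ 2 - 1) = 1 + (y * v) ^ 2 by ring,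
      rpow_neg_half_eq_inv_sqrt hpos.le, smul_eq_mul]
    have hsq := Real.sq_sqrt hpos.le
    have hne := (Real.sqrt_pos.2 hpos).ne'
    set s := √(1 + (y * v) ^ 2)
    field_simp
    linear_combination hsq

lemma arcsin_sub_mul_sqrt_eq {y : ℝ} (hy : 0 < y) (hy1 : y < 1) :
    Real.arcsin y - y * √(1 - y ^ 2) =
      2 * y ^ 3 * weightedRpowIntegral 2 (-(1 / 2)) (1 - y ^ 2) := by
  have ht : 0 < 1 - y ^ 2 := by nlinarith
  have h := intervalIntegral.integral_eq_sub_of_hasDerivAt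
    (f := fun v : ℝ => (Real.arcsin (y * v) - y * v * √(1 - (y * v) ^ 2)) / (2 * y ^ 3))
    (fun v hv => ?_) (intervalIntegrable_weightedRpow 2 (-(1 / 2)) ht)
  · rw [weightedRpowIntegral, h]
    simp
    field_simp
  · rw [Set.uIcc_of_le zero_le_one] at hv
    have heq : 1 + v ^ 2 * (1 - y ^ 2 - 1) = 1 - (y * v) ^ 2 := by ring
    have hpos := one_add_sq_mul_sub_one_pos hv ht
    rw [heq] at hpos
    have hw : HasDerivAt (fun v : ℝ => y * v) y v := by
      simpa using (hasDerivAt_id v).const_mul y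
    have hs : HasDerivAt (fun v : ℝ => 1 - (y * v) ^ 2) (-(2 * (y * v) * y)) v := by
      simpa using (hw.pow 2).const_sub 1
    have ha := (Real.hasDerivAt_arcsin (x := y * v) (fun h => by simp [h] at hpos)
      (fun h => by simp [h] at hpos)).comp v hw
    refine ((ha.sub (hw.mul (hs.sqrt hpos.ne'))).div_const (2 * y ^ 3)).congr_deriv ?_
    rw [heq, rpow_neg_half_eq_inv_sqrt hpos.le]
    have hsq := Real.sq_sqrt hpos.le
    have hne := (Real.sqrt_pos.2 hpos).ne'
    set s := √(1 - (y * v) ^ 2)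
    field_simp
    linear_combination -hsq

/-- The smooth positive factor in `Θ(t) = (t - 1) * thetaFactor t`. -/
def thetaFactor (t : ℝ) : ℝ :=
  (3 / 2 * weightedRpowIntegral 2 (-(1 / 2)) t) ^ ((2 : ℝ) / 3)

lemma three_fourths_mul_rpow_two_thirds {y : ℝ} (hy : 0 < y) {t : ℝ} (ht : 0 < t) :
    (3 / 4 * (2 * y ^ 3 * weightedRpowIntegral 2 (-(1 / 2)) t)) ^ ((2 : ℝ) / 3) =
      y ^ 2 * thetaFactor t := by
  have hG := weightedRpowIntegral_pos 2 (-(1 / 2)) ht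
  have h : (y ^ 3) ^ ((2 : ℝ) / 3) = y ^ 2 := by
    rw [← Real.rpow_natCast y 3, ← Real.rpow_mul hy.le, ← Real.rpow_natCast y 2]
    norm_num
  rw [thetaFactor, ← h, ← Real.mul_rpow (by positivity) (by positivity)]
  ring_nf

lemma ThetaFun_one : ThetaFun 1 = 0 := by
  simp [ThetaFun]

lemma ThetaFun_eq_mul_thetaFactor {t : ℝ} (ht : 0 < t) :
    ThetaFun t = (t - 1) * thetaFactor t := by
  rcases lt_trichotomy t 1 with h | rfl | h
  · have hx : 0 < 1 - t := by linarith
    have hy := Real.sqrt_pos.2 hx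
    have hsq := Real.sq_sqrt hx.le
    have hy1 : √(1 - t) < 1 := by nlinarith
    have hb := arcsin_sub_mul_sqrt_eq hy hy1
    rw [hsq, sub_sub_cancel] at hb
    rw [ThetaFun, if_pos h, Real.arccos_eq_arcsin (Real.sqrt_nonneg t), Real.sq_sqrt ht.le,
      show t - t ^ 2 = (1 - t) * t by ring, Real.sqrt_mul hx.le, hb,
      three_fourths_mul_rpow_two_thirds hy ht, hsq]
    ring
  · simp [ThetaFun_one]
  · have hx : 0 < t - 1 := by linarith
    have hy := Real.sqrt_pos.2 hx
    have hsq := Real.sq_sqrt hx.le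
    have hb := mul_sqrt_sub_arsinh_eq hy
    rw [Real.arsinh, hsq, add_sub_cancel] at hb
    rw [ThetaFun, if_neg h.not_gt, show t ^ 2 - t = (t - 1) * t by ring, Real.sqrt_mul hx.le,
      add_comm √t, hb, three_fourths_mul_rpow_two_thirds hy ht, hsq]

lemma contDiffOn_thetaFactor : ContDiffOn ℝ (⊤ : ℕ∞) thetaFactor (Set.Ioi 0) :=
  (contDiffOn_const.mul (contDiffOn_weightedRpowIntegral 2 (-(1 / 2)))).rpow_const_of_ne
    fun _ ht => (mul_pos (by norm_num) (weightedRpowIntegral_pos 2 _ ht)).ne'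

lemma thetaFactor_one : thetaFactor 1 = (2 : ℝ) ^ (-(2 : ℝ) / 3) := by
  rw [thetaFactor, weightedRpowIntegral_at_one, neg_div, Real.rpow_neg (by norm_num),
    ← Real.inv_rpow (by norm_num)]
  norm_num

lemma hasDerivAt_ThetaFun {t : ℝ} (ht : 0 < t) :
    HasDerivAt ThetaFun ((3 / 2 * weightedRpowIntegral 2 (-(1 / 2)) t) ^ (-(1 / 3) : ℝ) *
      (1 / 2 * t ^ (-(1 / 2) : ℝ))) t := by
  have hG : 0 < 3 / 2 * weightedRpowIntegral 2 (-(1 / 2)) t :=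
    mul_pos (by norm_num) (weightedRpowIntegral_pos 2 _ ht)
  have hd := ((hasDerivAt_weightedRpowIntegral 2 (-(1 / 2)) ht).const_mul (3 / 2)).rpow_const
    (p := (2 : ℝ) / 3) (Or.inl hG.ne')
  have hprod := ((hasDerivAt_id t).sub_const 1).mul hd
  have heq : ThetaFun =ᶠ[nhds t] fun t => (t - 1) * thetaFactor t :=
    (lt_mem_nhds ht).mono fun _ hx => ThetaFun_eq_mul_thetaFactor hx
  refine HasDerivAt.congr_of_eventuallyEq (hprod.congr_deriv ?_) heq
  have hsplit : (3 / 2 * weightedRpowIntegral 2 (-(1 / 2)) t) ^ ((2 : ℝ) / 3) =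
      (3 / 2 * weightedRpowIntegral 2 (-(1 / 2)) t) ^ (-(1 / 3) : ℝ) *
        (3 / 2 * weightedRpowIntegral 2 (-(1 / 2)) t) := by
    rw [← Real.rpow_add_one hG.ne']
    norm_num
  have hrec := weightedRpowIntegral_recurrence 2 (-(1 / 2)) ht
  rw [← hrec, hsplit, show (2 : ℝ) / 3 - 1 = -(1 / 3) by norm_num]
  simp only [id]
  push_cast
  ring

/-- Properties of `Θ`: (i) `Θ` is smooth on `(0,∞)`;
(ii) `Θ′(t) > 0` for `t > 0`; (iii) `Θ(1) = 0`;
(iv) `Θ(t) = 2^{−2/3}(t−1)(1+O(t−1))` as `t → 1`;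
(v) for every `ε > 0` there is `C_ε > 0` with `C_ε t^{2/3} ≤ Θ(t) ≤ ((3/4)t)^{2/3}`
for all `t ≥ 1+ε`. -/
theorem ThetaFun_properties :
    ContDiffOn ℝ (⊤ : ℕ∞) ThetaFun (Set.Ioi (0 : ℝ)) ∧
    (∀ t : ℝ, 0 < t → 0 < deriv ThetaFun t) ∧
    ThetaFun 1 = 0 ∧
    (∃ C > (0 : ℝ), ∃ δ > (0 : ℝ), ∀ t : ℝ, |t - 1| < δ →
      |ThetaFun t - (2 : ℝ) ^ (-(2 : ℝ) / 3) * (t - 1)| ≤ C * (t - 1) ^ 2) ∧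
    (∀ ε > (0 : ℝ), ∃ Cε > (0 : ℝ), ∀ t : ℝ, 1 + ε ≤ t →
      Cε * t ^ ((2 : ℝ) / 3) ≤ ThetaFun t ∧ ThetaFun t ≤ ((3 / 4) * t) ^ ((2 : ℝ) / 3)) := by
  refine ⟨?_, fun t ht => ?_, ThetaFun_one, ?_, fun ε hε => ?_⟩
  · exact ((contDiffOn_id.sub contDiffOn_const).mul contDiffOn_thetaFactor).congr
      fun t ht => ThetaFun_eq_mul_thetaFactor ht
  · rw [(hasDerivAt_ThetaFun ht).deriv]
    have hG := weightedRpowIntegral_pos 2 (-(1 / 2)) ht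
    positivity
  · have hdiff : DifferentiableAt ℝ thetaFactor 1 :=
      (contDiffOn_thetaFactor.differentiableOn (by simp)).differentiableAt
        (Ioi_mem_nhds zero_lt_one)
    obtain ⟨C, hC, hbound⟩ := hdiff.isBigO_sub.exists_pos
    obtain ⟨δ, hδ, hball⟩ := Metric.eventually_nhds_iff.1
      (hbound.bound.and (lt_mem_nhds (zero_lt_one' ℝ)))
    refine ⟨C, hC, δ, hδ, fun t ht => ?_⟩
    obtain ⟨hle, hpos⟩ := hball (y := t) (by rwa [Real.dist_eq])
    rw [Real.norm_eq_abs, Real.norm_eq_abs, thetaFactor_one] at hle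
    rw [ThetaFun_eq_mul_thetaFactor hpos, mul_comm (_ ^ _), ← mul_sub, abs_mul, ← sq_abs (t - 1)]
    nlinarith [mul_le_mul_of_nonneg_left hle (abs_nonneg (t - 1))]
  · refine ⟨ε / (1 + ε) * (1 / 2) ^ ((2 : ℝ) / 3), by positivity, fun t ht => ⟨?_, ?_⟩⟩
    · have ht0 : 0 < t := by linarith
      have hfac : (1 / 2 : ℝ) ^ ((2 : ℝ) / 3) * t ^ (-(1 / 3) : ℝ) ≤ thetaFactor t := by
        have h := rpow_div_le_weightedRpowIntegral 2 (p := -(1 / 2)) (by norm_num)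
          (by linarith : 1 ≤ t)
        have hexp : t ^ (-(1 / 3) : ℝ) = (t ^ (-(1 / 2) : ℝ)) ^ ((2 : ℝ) / 3) := by
          rw [← Real.rpow_mul ht0.le]
          norm_num
        rw [hexp, ← Real.mul_rpow (by norm_num) (by positivity)]
        refine Real.rpow_le_rpow (by positivity) ?_ (by norm_num)
        push_cast at h
        linarith
      have hlin : ε / (1 + ε) * t ≤ t - 1 := by
        rw [div_mul_eq_mul_div, div_le_iff₀ (by linarith)]
        linarith
      have hsplit : t ^ ((2 : ℝ) / 3) = t * t ^ (-(1 / 3) : ℝ) := by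
        rw [mul_comm, ← Real.rpow_add_one ht0.ne']
        norm_num
      rw [ThetaFun_eq_mul_thetaFactor ht0, hsplit]
      calc ε / (1 + ε) * (1 / 2) ^ ((2 : ℝ) / 3) * (t * t ^ (-(1 / 3) : ℝ))
          = ε / (1 + ε) * t * ((1 / 2) ^ ((2 : ℝ) / 3) * t ^ (-(1 / 3) : ℝ)) := by ring
        _ ≤ (t - 1) * thetaFactor t := by
          refine mul_le_mul hlin hfac (by positivity) (by linarith)
    · have h1 : 1 ≤ t := by linarith
      have ht0 : 0 < t := by linarith
      have hx : 0 < t - 1 := by linarith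
      have hy := Real.sqrt_pos.2 hx
      have hb := mul_sqrt_sub_arsinh_eq hy
      rw [Real.arsinh, Real.sq_sqrt hx.le, add_sub_cancel] at hb
      have hG := weightedRpowIntegral_pos 2 (-(1 / 2)) ht0
      have hsqrt : √(t ^ 2 - t) ≤ t := Real.sqrt_le_iff.2 ⟨ht0.le, by linarith⟩
      have hlog : 0 ≤ Real.log (√t + √(t - 1)) :=
        Real.log_nonneg (by linarith [Real.one_le_sqrt.2 h1])
      rw [ThetaFun, if_neg h1.not_gt]
      refine Real.rpow_le_rpow ?_ (by linarith) (by norm_num)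
      rw [show t ^ 2 - t = (t - 1) * t by ring, Real.sqrt_mul hx.le, add_comm √t, hb]
      positivity
end
end

section
/- Let m ∈ ℕ and let J_m be the Bessel function of the first kind of order m. Then there exists c > 0 such that for all real a, b with 1 < a < b−1, ∫_a^b x·J_m(x)² dx > c·(b−a). -/
open MeasureTheory Complex

noncomputable section

/-- The Bessel function of the first kind of integer order `m`:
`J_m(x) = Σ_{j=0}^∞ ((−1)^j/(j!(m+j)!)) (x/2)^{2j+m}`. -/
def besselJ (m : ℕ) (x : ℝ) : ℝ :=
  ∑' j : ℕ, ((-1) ^ j / ((j.factorial : ℝ) * ((m + j).factorial : ℝ))) * (x / 2) ^ (2 * j + m)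

/-- The coefficients of the entire function `G_m` with `J_m(x) = (x/2)^m G_m(x²/4)`. -/
def besselCoeff (m j : ℕ) : ℝ :=
  (-1) ^ j / ((j.factorial : ℝ) * ((m + j).factorial : ℝ))

/-- The entire function `G_m` with `J_m(x) = (x/2)^m G_m(x²/4)`. -/
def besselSeries (m : ℕ) (z : ℝ) : ℝ := ∑' j : ℕ, besselCoeff m j * z ^ j

lemma abs_besselCoeff_le (m j : ℕ) : |besselCoeff m j| ≤ 1 / (j.factorial : ℝ) := by
  have h1 : (0 : ℝ) < j.factorial := by positivity
  have h2 : (1 : ℝ) ≤ (m + j).factorial := by exact_mod_cast Nat.one_le_of_lt (Nat.factorial_pos _)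
  rw [besselCoeff, abs_div, abs_pow, abs_neg, abs_one, one_pow, abs_of_pos (by positivity)]
  exact one_div_le_one_div_of_le h1 (le_mul_of_one_le_right h1.le h2)

lemma summable_besselCoeff (m : ℕ) (z : ℝ) : Summable fun j => besselCoeff m j * z ^ j := by
  refine Summable.of_norm_bounded (Real.summable_pow_div_factorial |z|) fun j => ?_
  rw [Real.norm_eq_abs, abs_mul, abs_pow]
  calc |besselCoeff m j| * |z| ^ j ≤ 1 / (j.factorial : ℝ) * |z| ^ j := by
        gcongr; exact abs_besselCoeff_le m j
    _ = |z| ^ j / (j.factorial : ℝ) := by ring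

lemma succ_mul_besselCoeff_succ (m j : ℕ) :
    ((j + 1 : ℕ) : ℝ) * besselCoeff m (j + 1) = -besselCoeff (m + 1) j := by
  have h : m + (j + 1) = m + 1 + j := by ring
  rw [besselCoeff, besselCoeff, Nat.factorial_succ j, h, pow_succ]
  push_cast
  field_simp

lemma hasDerivAt_besselSeries (m : ℕ) (z : ℝ) :
    HasDerivAt (besselSeries m) (-besselSeries (m + 1) z) z := by
  set R : ℝ := |z| + 1
  have hR : 0 < R := by positivity
  have hu : Summable fun n : ℕ => (1 / (n.factorial : ℝ)) * (n * R ^ (n - 1)) := by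
    rw [← summable_nat_add_iff 1]
    refine (Real.summable_pow_div_factorial R).congr fun n => ?_
    rw [Nat.factorial_succ, Nat.add_sub_cancel]
    push_cast
    field_simp
  have key : HasDerivAt (fun w => ∑' n, besselCoeff m n * w ^ n)
      (∑' n : ℕ, besselCoeff m n * (n * z ^ (n - 1))) z := by
    refine hasDerivAt_tsum_of_isPreconnected (g := fun n w => besselCoeff m n * w ^ n)
      (g' := fun n w => besselCoeff m n * (n * w ^ (n - 1))) (t := Metric.ball 0 R) (y₀ := 0)
      hu Metric.isOpen_ball (convex_ball (0 : ℝ) R).isPreconnected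
      (fun n y _ => (hasDerivAt_pow n y).const_mul _) ?_
      (Metric.mem_ball_self hR) (summable_besselCoeff m 0) ?_
    · intro n y hy
      rw [mem_ball_zero_iff, Real.norm_eq_abs] at hy
      rw [Real.norm_eq_abs, abs_mul, abs_mul, abs_pow, Nat.abs_cast]
      gcongr
      exact abs_besselCoeff_le m n
    · rw [mem_ball_zero_iff, Real.norm_eq_abs]
      exact lt_add_one _
  have hs : Summable fun n : ℕ => besselCoeff m n * (n * z ^ (n - 1)) := by
    rw [← summable_nat_add_iff 1]
    refine (summable_besselCoeff (m + 1) z).neg.congr fun n => ?_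
    rw [Nat.add_sub_cancel, ← neg_mul, ← succ_mul_besselCoeff_succ]
    ring
  refine key.congr_deriv ?_
  rw [hs.tsum_eq_zero_add, besselSeries, ← tsum_neg]
  simp only [Nat.cast_zero, zero_mul, mul_zero, zero_add]
  refine tsum_congr fun n => ?_
  rw [Nat.add_sub_cancel, ← neg_mul, ← succ_mul_besselCoeff_succ]
  ring

lemma continuous_besselSeries (m : ℕ) : Continuous (besselSeries m) :=
  continuous_iff_continuousAt.2 fun z => (hasDerivAt_besselSeries m z).continuousAt

lemma besselSeries_eq (m : ℕ) (z : ℝ) :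
    besselSeries m z = (m + 1) * besselSeries (m + 1) z - z * besselSeries (m + 2) z := by
  have h0 := summable_besselCoeff m z
  have h1 := summable_besselCoeff (m + 1) z
  have h2 := summable_besselCoeff (m + 2) z
  simp only [besselSeries]
  rw [h0.tsum_eq_zero_add, h1.tsum_eq_zero_add, mul_add, ← tsum_mul_left, ← tsum_mul_left,
    add_sub_assoc,
    ← Summable.tsum_sub (((summable_nat_add_iff 1).2 h1).mul_left _) (h2.mul_left _)]
  congr 1
  · simp [besselCoeff, Nat.factorial_succ]
    field_simp
  · refine tsum_congr fun j => ?_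
    have e0 : m + (j + 1) = m + j + 1 := by ring
    have e1 : m + 1 + (j + 1) = m + j + 1 + 1 := by ring
    have e2 : m + 2 + j = m + j + 1 + 1 := by ring
    simp only [besselCoeff, e0, e1, e2, Nat.factorial_succ]
    push_cast
    field_simp
    ring

lemma besselJ_eq (m : ℕ) (x : ℝ) :
    besselJ m x = (x / 2) ^ m * besselSeries m ((x / 2) ^ 2) := by
  rw [besselJ, besselSeries, ← tsum_mul_left]
  refine tsum_congr fun j => ?_
  rw [besselCoeff, pow_add, pow_mul]
  ring

lemma continuous_besselJ (m : ℕ) : Continuous (besselJ m) := by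
  have h := continuous_besselSeries m
  rw [funext (besselJ_eq m)]
  fun_prop

lemma besselJ_add_besselJ (m : ℕ) {x : ℝ} (hx : x ≠ 0) :
    besselJ m x + besselJ (m + 2) x = 2 * (m + 1) / x * besselJ (m + 1) x := by
  rw [besselJ_eq, besselJ_eq, besselJ_eq, besselSeries_eq m, pow_succ _ (m + 1), pow_succ]
  field_simp
  ring

lemma hasDerivAt_besselJ (m : ℕ) {x : ℝ} (hx : x ≠ 0) :
    HasDerivAt (besselJ m) (m / x * besselJ m x - besselJ (m + 1) x) x := by
  have h1 : HasDerivAt (fun x : ℝ => x / 2) (1 / 2) x := (hasDerivAt_id x).div_const 2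
  have h2 := (h1.fun_pow m).fun_mul
    ((hasDerivAt_besselSeries m ((x / 2) ^ 2)).comp x (h1.fun_pow 2))
  rw [besselJ_eq m, besselJ_eq (m + 1), funext (besselJ_eq m)]
  refine h2.congr_deriv ?_
  rcases m with _ | m
  · simp
    ring
  · simp only [Nat.add_sub_cancel, pow_succ, Function.comp]
    push_cast
    field_simp
    ring

lemma hasDerivAt_besselJ_succ (m : ℕ) {x : ℝ} (hx : x ≠ 0) :
    HasDerivAt (besselJ (m + 1)) (besselJ m x - (m + 1) / x * besselJ (m + 1) x) x := by
  refine (hasDerivAt_besselJ (m + 1) hx).congr_deriv ?_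
  have h := besselJ_add_besselJ m hx
  push_cast
  linear_combination -h

lemma exists_besselJ_ne_zero (m : ℕ) : ∃ x, 0 < x ∧ x < 1 ∧ besselJ m x ≠ 0 := by
  have h0 : besselSeries m ((0 / 2) ^ 2) ≠ 0 := by
    rw [besselSeries, tsum_eq_single 0 (fun j hj => by simp [hj])]
    simp [besselCoeff, Nat.factorial_ne_zero]
  have hc : ContinuousAt (fun x : ℝ => besselSeries m ((x / 2) ^ 2)) 0 := by
    have h := continuous_besselSeries m
    exact Continuous.continuousAt (by fun_prop)
  obtain ⟨ε, hε, h⟩ := Metric.eventually_nhds_iff.1 (hc.eventually_ne h0)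
  have hpos : 0 < min ε 1 / 2 := by positivity
  refine ⟨min ε 1 / 2, hpos, by linarith [min_le_right ε 1], ?_⟩
  rw [besselJ_eq]
  refine mul_ne_zero (by positivity) (h ?_)
  rw [Real.dist_eq, sub_zero, abs_of_pos hpos]
  linarith [min_le_left ε 1]

section Oscillator

variable {y v : ℝ → ℝ} {K : ℝ}

/-- If `u = √x y` solves `u'' + (1 - K/x²) u = 0` and `v = u'/√x`, then the energy
`u² + u'² = x (v² + y²)` is almost nondecreasing. -/
lemma energy_mul_exp_le (hy : ∀ x > 0, HasDerivAt y (v x - y x / (2 * x)) x)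
    (hv : ∀ x > 0, HasDerivAt v (-v x / (2 * x) - (1 - K / x ^ 2) * y x) x)
    {s x : ℝ} (hs : 0 < s) (hsx : s ≤ x) :
    s * (v s ^ 2 + y s ^ 2) * Real.exp (-|K| / s) ≤ x * (v x ^ 2 + y x ^ 2) := by
  have hd : ∀ x > 0, HasDerivAt (fun x => x * (v x ^ 2 + y x ^ 2) * Real.exp (-|K| / x))
      (((2 * K * v x * y x + |K| * (v x ^ 2 + y x ^ 2)) / x) * Real.exp (-|K| / x)) x := by
    intro x hx
    have hE := (hasDerivAt_id' x).fun_mul (((hv x hx).fun_pow 2).fun_add ((hy x hx).fun_pow 2))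
    have hexp := ((hasDerivAt_const x (-|K|)).fun_div (hasDerivAt_id' x) hx.ne').exp
    refine (hE.fun_mul hexp).congr_deriv ?_
    push_cast
    field_simp
    ring
  have hmono : MonotoneOn (fun x => x * (v x ^ 2 + y x ^ 2) * Real.exp (-|K| / x))
      (Set.Ioi 0) := by
    refine monotoneOn_of_deriv_nonneg (convex_Ioi 0)
      (fun x hx => (hd x hx).continuousAt.continuousWithinAt) ?_ ?_ <;> rw [interior_Ioi]
    · exact fun x hx => (hd x hx).differentiableAt.differentiableWithinAt
    · intro x hx
      rw [(hd x hx).deriv]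
      have hx' : 0 < x := hx
      have h : 0 ≤ 2 * K * v x * y x + |K| * (v x ^ 2 + y x ^ 2) := by
        rcases abs_cases K with ⟨h, hK⟩ | ⟨h, hK⟩ <;> rw [h]
        · nlinarith [mul_nonneg hK (sq_nonneg (v x + y x))]
        · nlinarith [mul_nonneg (neg_nonneg.2 hK.le) (sq_nonneg (v x - y x))]
      positivity
  have hx := hs.trans_le hsx
  refine (hmono hs hx hsx).trans (mul_le_of_le_one_right (by positivity) ?_)
  rw [Real.exp_le_one_iff, neg_div, neg_nonpos]
  positivity

/-- A lower bound for the energy `u² + u'²` yields a lower bound for the mean square of `u` over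
unit intervals, by testing the equation against a bump function. -/
lemma le_integral_unit_interval (hyc : Continuous y)
    (hy : ∀ x > 0, HasDerivAt y (v x - y x / (2 * x)) x)
    (hv : ∀ x > 0, HasDerivAt v (-v x / (2 * x) - (1 - K / x ^ 2) * y x) x)
    {t e : ℝ} (ht : 1 ≤ t) (he : ∀ x ≥ t, e ≤ x * (v x ^ 2 + y x ^ 2)) :
    e / 30 ≤ (3 + |K|) * ∫ x in t..t + 1, x * y x ^ 2 := by
  let g : ℝ → ℝ := fun x =>
    e * ((x - t) ^ 3 / 3 - (x - t) ^ 4 / 2 + (x - t) ^ 5 / 5)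
      - (((x - t) - (x - t) ^ 2) ^ 2 * (x * y x * v x)
        - ((x - t) - (x - t) ^ 2) * (1 - 2 * (x - t)) * (x * y x ^ 2))
  have hg : ∀ x > 0, HasDerivAt g
      (((x - t) - (x - t) ^ 2) ^ 2 * (e - x * v x ^ 2 + (1 - K / x ^ 2) * (x * y x ^ 2))
        + (1 - 6 * (x - t) + 6 * (x - t) ^ 2) * (x * y x ^ 2)) x := by
    intro x hx
    have hs : HasDerivAt (fun x => x - t) 1 x := (hasDerivAt_id' x).sub_const t
    have h1 := ((((hs.fun_pow 3).div_const 3).fun_sub ((hs.fun_pow 4).div_const 2)).fun_add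
      ((hs.fun_pow 5).div_const 5)).const_mul e
    have hb := hs.fun_sub (hs.fun_pow 2)
    have h2 := (hb.fun_pow 2).fun_mul (((hasDerivAt_id' x).fun_mul (hy x hx)).fun_mul (hv x hx))
    have h3 := (hb.fun_mul ((hs.const_mul 2).const_sub 1)).fun_mul
      ((hasDerivAt_id' x).fun_mul ((hy x hx).fun_pow 2))
    refine (h1.fun_sub (h2.fun_sub h3)).congr_deriv ?_
    push_cast
    field_simp
    ring
  have hpos : ∀ x, t ≤ x → 0 < x := fun x hx => by linarith
  have key := intervalIntegral.sub_le_integral_of_hasDeriv_right_of_le (a := t) (b := t + 1)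
    (φ := fun x => (3 + |K|) * (x * y x ^ 2)) (by linarith)
    (fun x hx => (hg x (hpos x hx.1)).continuousAt.continuousWithinAt)
    (fun x hx => (hg x (hpos x hx.1.le)).hasDerivWithinAt)
    (Continuous.integrableOn_Icc (by fun_prop)) ?_
  · rw [intervalIntegral.integral_const_mul] at key
    refine le_trans (le_of_eq ?_) key
    simp only [g]
    ring
  · rintro x ⟨hx1, hx2⟩
    have hx := hpos x hx1.le
    have hE := he x hx1.le
    set s := x - t with hs
    have hs0 : 0 ≤ s := by linarith
    have hs1 : s ≤ 1 := by linarith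
    have hY : 0 ≤ x * y x ^ 2 := by positivity
    have hφ0 : 0 ≤ (s - s ^ 2) ^ 2 := sq_nonneg _
    have hφ1 : (s - s ^ 2) ^ 2 ≤ 1 := by
      have h0 : 0 ≤ s - s ^ 2 := by nlinarith
      have h1 : s - s ^ 2 ≤ 1 := by nlinarith
      nlinarith
    have hK : -K / x ^ 2 ≤ |K| := by
      rw [div_le_iff₀ (by positivity)]
      have : 1 ≤ x ^ 2 := by nlinarith
      nlinarith [neg_abs_le K, abs_nonneg K]
    have hb : 1 - 6 * s + 6 * s ^ 2 ≤ 1 := by nlinarith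
    have e1 : (s - s ^ 2) ^ 2 * (e - x * v x ^ 2 + (1 - K / x ^ 2) * (x * y x ^ 2))
        ≤ (s - s ^ 2) ^ 2 * ((2 + |K|) * (x * y x ^ 2)) := by
      refine mul_le_mul_of_nonneg_left ?_ hφ0
      have := mul_le_mul_of_nonneg_right hK hY
      rw [neg_div] at this
      linarith
    have e2 : (s - s ^ 2) ^ 2 * ((2 + |K|) * (x * y x ^ 2)) ≤ (2 + |K|) * (x * y x ^ 2) :=
      mul_le_of_le_one_left (by positivity) hφ1
    have e3 := mul_le_mul_of_nonneg_right hb hY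
    linarith

end Oscillator

/-- A nonnegative function whose integrals over unit intervals are bounded below has integrals
growing at least linearly. -/
lemma linear_lower_bound_of_unit_intervals {f : ℝ → ℝ} (hf : Continuous f)
    (h0 : ∀ x ≥ 1, 0 ≤ f x) {δ : ℝ} (hδ : 0 < δ)
    (h : ∀ t ≥ 1, δ ≤ ∫ x in t..t + 1, f x) {a b : ℝ} (ha : 1 < a) (hab : a < b - 1) :
    δ / 2 * (b - a) < ∫ x in a..b, f x := by
  set n := ⌊b - a⌋₊
  have hn : (n : ℝ) ≤ b - a := Nat.floor_le (by linarith)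
  have hn' : b - a < n + 1 := Nat.lt_floor_add_one _
  have hn1 : (1 : ℝ) ≤ n := by exact_mod_cast Nat.le_floor (by push_cast; linarith)
  have hsum := intervalIntegral.sum_integral_adjacent_intervals (μ := volume) (f := f)
    (a := fun k : ℕ => a + k) (n := n) fun k _ => hf.intervalIntegrable _ _
  have hle : (n : ℝ) * δ ≤ ∫ x in a..a + n, f x := by
    simp only [Nat.cast_zero, add_zero] at hsum
    rw [← hsum, ← nsmul_eq_mul]
    refine le_of_eq_of_le ?_ (Finset.card_nsmul_le_sum (Finset.range n) _ δ fun k _ => ?_)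
    · rw [Finset.card_range]
    · have hk : (0 : ℝ) ≤ k := k.cast_nonneg
      have := h (a + k) (by linarith)
      push_cast
      rwa [← add_assoc]
  have hrest : 0 ≤ ∫ x in a + n..b, f x :=
    intervalIntegral.integral_nonneg (by linarith) fun x hx => h0 x (by linarith [hx.1])
  rw [← intervalIntegral.integral_add_adjacent_intervals (hf.intervalIntegrable a (a + n))
    (hf.intervalIntegrable (a + n) b)]
  nlinarith

/-- There exists `c > 0` such that for all `1 < a < b − 1`,
`∫_a^b x J_m(x)² dx > c (b − a)`. -/
theorem integral_bessel_sq_lower_bound (m : ℕ) :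
    ∃ c > (0 : ℝ), ∀ a b : ℝ, 1 < a → a < b - 1 →
      c * (b - a) < ∫ x in a..b, x * besselJ m x ^ 2 := by
  let v : ℝ → ℝ := fun x => (m + 1 / 2) / x * besselJ m x - besselJ (m + 1) x
  let K : ℝ := m ^ 2 - 1 / 4
  have hy : ∀ x > 0, HasDerivAt (besselJ m) (v x - besselJ m x / (2 * x)) x := by
    intro x hx
    refine (hasDerivAt_besselJ m hx.ne').congr_deriv ?_
    simp only [v]
    field_simp
    ring
  have hv : ∀ x > 0, HasDerivAt v (-v x / (2 * x) - (1 - K / x ^ 2) * besselJ m x) x := by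
    intro x hx
    have h := (((hasDerivAt_const x (m + 1 / 2 : ℝ)).fun_div (hasDerivAt_id' x) hx.ne').fun_mul
      (hasDerivAt_besselJ m hx.ne')).fun_sub (hasDerivAt_besselJ_succ m hx.ne')
    refine h.congr_deriv ?_
    simp only [v, K]
    field_simp
    ring
  have hcont := continuous_besselJ m
  obtain ⟨s, hs0, hs1, hs⟩ := exists_besselJ_ne_zero m
  set e : ℝ := s * (v s ^ 2 + besselJ m s ^ 2) * Real.exp (-|K| / s)
  have he : 0 < e := by positivity
  refine ⟨e / 30 / (3 + |K|) / 2, by positivity, fun a b ha hab => ?_⟩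
  refine linear_lower_bound_of_unit_intervals (f := fun x => x * besselJ m x ^ 2) (by fun_prop)
    (fun x hx => by positivity) (by positivity) (fun t ht => ?_) ha hab
  rw [div_le_iff₀' (by positivity)]
  exact le_integral_unit_interval hcont hy hv ht fun x hx =>
    energy_mul_exp_le hy hv hs0 (by linarith)
end
end
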